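/- The map φ_# intertwines the swap involution on ℚ⟨Y^bi⟩ with the involution τ on ℚ⟨B⟩⁰: one has φ_# ∘ swap = τ ∘ φ_# as ℚ-linear maps ℚ⟨Y^bi⟩ → ℚ⟨B⟩⁰. -/

import Mathlib

/-!
STATEMENT 12: `φ_# ∘ swap = τ ∘ φ_#` on `ℚ⟨Y^bi⟩`.

`ℚ⟨Y^bi⟩` is realized as `List (ℕ × ℕ) →₀ ℚ`, the letter `y_{k,m}` (`k ≥ 1`) being
encoded as `(k-1, m)`; `ℚ⟨B⟩` is realized as `List ℕ →₀ ℚ`.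

The `ℚ`-linear map `swap` is characterized by its defining generating-series
property: for every depth `d` and all exponents `(x, y)`,
`swap(y_{x₁+1,y₁}⋯y_{x_d+1,y_d}) = (∏ yᵢ!) ∑_{w'} coeff_{(x,y)}(ρsub(w')) · w'`,
where for a word `w'` with letters `(Aᵢ, Mᵢ)` (i.e. `y_{Aᵢ+1,Mᵢ}`),
`ρsub(w') = ∏_i (Y₁+⋯+Y_{d+1-i})^{Aᵢ}·(X_{d+1-i}-X_{d+2-i})^{Mᵢ}/Mᵢ!` (convention
`X_{d+1} = 0`) is the image of `ρ(w')` under the substitution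
`X_i ↦ Y₁+⋯+Y_{d+1-i}`, `Y_i ↦ X_{d+1-i}-X_{d+2-i}`; the sum over `w'` is cut off at
(total) degree `N = ∑(xᵢ+yᵢ)`, which captures all nonzero contributions since
`ρsub(w')` is homogeneous of degree `∑(Aᵢ+Mᵢ)`.

The map `φ_#` is defined by expanding its defining generating series (statement 9).
The involution `τ` on `ℚ⟨B⟩⁰` maps `b_{k₁}b₀^{m₁}⋯b_{k_d}b₀^{m_d}` to
`b_{m_d+1}b₀^{k_d-1}⋯b_{m₁+1}b₀^{k₁-1}`.
-/

open Finsupp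

/-- `ℚ⟨Y^bi⟩`; a letter `(a, m)` stands for `y_{a+1,m}`. -/
abbrev QY : Type := List (ℕ × ℕ) →₀ ℚ

/-- `ℚ⟨B⟩`. -/
abbrev QB : Type := List ℕ →₀ ℚ

/-- The word `y_{k₁,m₁} ⋯ y_{k_d,m_d}` of `ℚ⟨Y^bi⟩`. -/
noncomputable def wY (w : List (ℕ × ℕ)) : QY := Finsupp.single w 1

/-- The word `b_{s₁} ⋯ b_{s_l}` of `ℚ⟨B⟩`. -/
noncomputable def wB (w : List ℕ) : QB := Finsupp.single w 1

/-- The set of matrices `c` (given by their columns `c j : Fin d → ℕ`) with column sums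
`∑_i c j i = m j` and vanishing strictly above the diagonal. -/
noncomputable def matSet (d : ℕ) (m : Fin d → ℕ) : Finset (Fin d → Fin d → ℕ) :=
  (Fintype.piFinset fun j : Fin d => Finset.Nat.antidiagonalTuple d (m j)).filter
    fun c => ∀ i j : Fin d, i < j → c j i = 0

/-- `φ_#` on the word with letters `y_{(w i).1 + 1, (w i).2}`. -/
noncomputable def phiW (w : List (ℕ × ℕ)) : QB :=
  ∑ c ∈ matSet w.length fun j => (w.get j).2,
    ((∏ j : Fin w.length, (((w.get j).2).factorial : ℚ)) *
        ∏ i : Fin w.length, (Nat.multinomial Finset.univ (fun j => c j i) : ℚ)) •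
      wB ((List.ofFn fun i : Fin w.length =>
        ((w.get i).1 + 1) :: List.replicate (∑ j : Fin w.length, c j i) 0).flatten)

/-- The map `φ_# : ℚ⟨Y^bi⟩ → ℚ⟨B⟩⁰ ⊆ ℚ⟨B⟩` (ℚ-linear extension). -/
noncomputable def phi (x : QY) : QB := x.sum fun w a => a • phiW w

/-- `τ` on words: `τ(b_{k₁}b₀^{m₁}⋯b_{k_d}b₀^{m_d}) = b_{m_d+1}b₀^{k_d-1}⋯b_{m₁+1}b₀^{k₁-1}`. -/
noncomputable def tauW : List ℕ → List ℕ
  | [] => []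
  | k :: rest =>
      tauW (rest.dropWhile (· = 0)) ++
        ((rest.takeWhile (· = 0)).length + 1) :: List.replicate (k - 1) 0
  termination_by w => w.length
  decreasing_by
    simp only [List.length_cons]
    exact Nat.lt_succ_of_le (List.dropWhile_sublist (· = 0)).length_le

/-- The involution `τ` on `ℚ⟨B⟩⁰ ⊆ ℚ⟨B⟩` (ℚ-linear extension). -/
noncomputable def tauQ (x : QB) : QB := Finsupp.mapDomain tauW x

/-- The polynomial
`∏_i (Y₁+⋯+Y_{d+1-i})^{A i} · (X_{d+1-i} - X_{d+2-i})^{B i} / (B i)!` in the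
variables `X_{j+1} = Sum.inl j`, `Y_{j+1} = Sum.inr j` (with `X_{d+1} = 0`): the
image of `ρ(y_{A₁+1,B₁}⋯y_{A_d+1,B_d})` under the swap substitution. -/
noncomputable def swapSubPoly (d : ℕ) (A B : Fin d → ℕ) :
    MvPolynomial (Fin d ⊕ Fin d) ℚ :=
  ∏ i : Fin d,
    ((∑ j : Fin d, if (j : ℕ) + (i : ℕ) < d then MvPolynomial.X (Sum.inr j) else 0) ^ A i *
      ((∑ j : Fin d, if (j : ℕ) + (i : ℕ) = d - 1 then MvPolynomial.X (Sum.inl j) else 0) -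
        (∑ j : Fin d, if (j : ℕ) + (i : ℕ) = d then MvPolynomial.X (Sum.inl j) else 0)) ^ B i *
      MvPolynomial.C (((B i).factorial : ℚ)⁻¹))

/-- the word -/
def wordB {d : ℕ} (k a : Fin d → ℕ) : List ℕ :=
  (List.ofFn fun i : Fin d => (k i + 1) :: List.replicate (a i) 0).flatten

/-- generating polynomial -/
noncomputable def genP {d : ℕ} (a : Fin d → ℕ) : MvPolynomial (Fin d) ℚ :=
  ∏ i : Fin d, (∑ j : Fin d, if j ≤ i then MvPolynomial.X j else 0) ^ a i

lemma tauW_block (k m : ℕ) (rest : List ℕ) (h : ∀ x ∈ rest.head?, x ≠ 0) :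
    tauW ((k + 1) :: (List.replicate m 0 ++ rest)) =
      tauW rest ++ (m + 1) :: List.replicate k 0 := by
  have h1 : (List.replicate m 0 ++ rest).dropWhile (· = 0) = rest := by
    rw [List.dropWhile_append_of_pos (by simp)]
    cases rest with
    | nil => rfl
    | cons x t => simp at h; simp [h]
  have h2 : (List.replicate m 0 ++ rest).takeWhile (· = 0) = List.replicate m 0 := by
    rw [List.takeWhile_append_of_pos (by simp)]
    cases rest with
    | nil => simp
    | cons x t => simp at h; simp [h]
  rw [tauW, h1, h2]
  simp

lemma tauW_wordB {d : ℕ} (k a : Fin d → ℕ) :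
    tauW (wordB k a) = wordB (fun i => a i.rev) (fun i => k i.rev) := by
  induction d with
  | zero => simp [wordB, tauW]
  | succ d ih =>
    have e1 : wordB k a = (k 0 + 1) :: (List.replicate (a 0) 0 ++
        wordB (fun i => k i.succ) (fun i => a i.succ)) := by
      simp [wordB, List.ofFn_succ]
    rw [e1, tauW_block, ih]
    · unfold wordB
      rw [List.ofFn_succ' (n := d)]
      simp [Fin.rev_castSucc, List.concat_eq_append]
    · cases d <;> simp [wordB, List.ofFn_succ]

lemma genP_homog {d : ℕ} (a : Fin d → ℕ) : (genP a).IsHomogeneous (∑ i, a i) := by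
  unfold genP
  apply MvPolynomial.IsHomogeneous.prod
  intro i _
  have := MvPolynomial.IsHomogeneous.pow (φ := (∑ j : Fin d, if j ≤ i then
    (MvPolynomial.X j : MvPolynomial (Fin d) ℚ) else 0)) (m := 1) ?_ (a i)
  · simpa using this
  · apply MvPolynomial.IsHomogeneous.sum
    intro j _
    split_ifs
    · exact MvPolynomial.isHomogeneous_X _ _
    · exact MvPolynomial.isHomogeneous_zero _ _ _

lemma swapSub_homog (d : ℕ) (A B : Fin d → ℕ) :
    (swapSubPoly d A B).IsHomogeneous (∑ i, (A i + B i)) := by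
  unfold swapSubPoly
  apply MvPolynomial.IsHomogeneous.prod
  intro i _
  have key : ∀ (c : Fin d → Prop) [DecidablePred c] (f : Fin d → Fin d ⊕ Fin d),
      (∑ j : Fin d, if c j then
        (MvPolynomial.X (f j) : MvPolynomial (Fin d ⊕ Fin d) ℚ) else 0).IsHomogeneous 1 := by
    intro c _ f
    apply MvPolynomial.IsHomogeneous.sum
    intro j _
    split_ifs
    · exact MvPolynomial.isHomogeneous_X _ _
    · exact MvPolynomial.isHomogeneous_zero _ _ _
  have h1 := (key (fun j => (j : ℕ) + (i : ℕ) < d) Sum.inr).pow (A i)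
  have h2 := ((key (fun j => (j : ℕ) + (i : ℕ) = d - 1) Sum.inl).sub
    (key (fun j => (j : ℕ) + (i : ℕ) = d) Sum.inl)).pow (B i)
  have h3 := (h1.mul h2).mul
    (MvPolynomial.isHomogeneous_C (Fin d ⊕ Fin d) (((B i).factorial : ℚ)⁻¹))
  simpa using h3

lemma coeff_rename_mul {d : ℕ} (x y : Fin d → ℕ) (G F : MvPolynomial (Fin d) ℚ) :
    MvPolynomial.coeff (Finsupp.equivFunOnFinite.symm (Sum.elim x y))
      (MvPolynomial.rename Sum.inr F * MvPolynomial.rename Sum.inl G) =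
    MvPolynomial.coeff (Finsupp.equivFunOnFinite.symm x) G *
      MvPolynomial.coeff (Finsupp.equivFunOnFinite.symm y) F := by
  induction F using MvPolynomial.induction_on' with
  | add p q hp hq => simp [add_mul, mul_add, hp, hq]
  | monomial u r =>
    induction G using MvPolynomial.induction_on' with
    | add p q hp hq => rw [map_add, mul_add, MvPolynomial.coeff_add, MvPolynomial.coeff_add, hp, hq, add_mul]
    | monomial v s =>
      simp only [MvPolynomial.rename_monomial, MvPolynomial.monomial_mul,
        MvPolynomial.coeff_monomial]
      have : (Finsupp.mapDomain Sum.inr u + Finsupp.mapDomain Sum.inl v =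
          Finsupp.equivFunOnFinite.symm (Sum.elim x y)) ↔
          (v = Finsupp.equivFunOnFinite.symm x ∧ u = Finsupp.equivFunOnFinite.symm y) := by
        constructor
        · intro h
          constructor
          · ext i
            have := DFunLike.congr_fun h (Sum.inl i)
            simpa [Finsupp.mapDomain_apply Sum.inl_injective,
              Finsupp.mapDomain_of_notMem_range] using this
          · ext i
            have := DFunLike.congr_fun h (Sum.inr i)
            simpa [Finsupp.mapDomain_apply Sum.inr_injective,
              Finsupp.mapDomain_of_notMem_range] using this
        · rintro ⟨rfl, rfl⟩
          ext (i | i)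
          · simp [Finsupp.mapDomain_apply Sum.inl_injective,
              Finsupp.mapDomain_of_notMem_range]
          · simp [Finsupp.mapDomain_apply Sum.inr_injective,
              Finsupp.mapDomain_of_notMem_range]
      simp only [this]
      by_cases h1 : v = Finsupp.equivFunOnFinite.symm x <;>
        by_cases h2 : u = Finsupp.equivFunOnFinite.symm y <;> simp [h1, h2, mul_comm]

lemma coeff_genP {d : ℕ} (a B : Fin d → ℕ) :
    MvPolynomial.coeff (Finsupp.equivFunOnFinite.symm B) (genP a) =
      ∑ c ∈ (matSet d B).filter (fun c => (fun i => ∑ j, c j i) = a),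
        ∏ i : Fin d, (Nat.multinomial Finset.univ (fun j => c j i) : ℚ) := by
  have hz : ∀ c : Fin d → Fin d → ℕ,
      (∏ i, ∏ j, (if j ≤ i then (MvPolynomial.X j : MvPolynomial (Fin d) ℚ) else 0) ^ (c i j))
      = if (∀ i j : Fin d, i < j → c i j = 0) then
        MvPolynomial.monomial (Finsupp.equivFunOnFinite.symm fun j => ∑ i, c i j) 1 else 0 := by
    intro c
    split_ifs with h
    · rw [MvPolynomial.monomial_eq, Finsupp.prod_fintype _ _ (by simp), Finset.prod_comm]
      simp only [MvPolynomial.C_1, one_mul, Finsupp.equivFunOnFinite_symm_apply_apply]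
      refine Finset.prod_congr rfl fun j _ => ?_
      rw [← Finset.prod_pow_eq_pow_sum]
      refine Finset.prod_congr rfl fun i _ => ?_
      split_ifs with hij
      · rfl
      · simp [h i j (not_le.mp hij)]
    · push Not at h
      obtain ⟨i, j, hij, hc⟩ := h
      refine Finset.prod_eq_zero (Finset.mem_univ i) (Finset.prod_eq_zero (Finset.mem_univ j) ?_)
      rw [if_neg (not_le.mpr hij), zero_pow hc]
  have hexp : genP a = ∑ c ∈ Fintype.piFinset fun i => Finset.piAntidiag Finset.univ (a i),
      ((∏ i : Fin d, (Nat.multinomial Finset.univ (c i) : ℚ)) •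
        if (∀ i j : Fin d, i < j → c i j = 0) then
        MvPolynomial.monomial (Finsupp.equivFunOnFinite.symm fun j => ∑ i, c i j) (1 : ℚ) else 0) := by
    unfold genP
    simp_rw [Finset.sum_pow_eq_sum_piAntidiag]
    rw [Finset.prod_univ_sum]
    refine Finset.sum_congr rfl fun c _ => ?_
    rw [← hz, Finset.prod_mul_distrib, MvPolynomial.smul_eq_C_mul]
    simp
  rw [hexp, MvPolynomial.coeff_sum]
  simp only [MvPolynomial.coeff_smul, apply_ite (MvPolynomial.coeff _),
    MvPolynomial.coeff_monomial, MvPolynomial.coeff_zero, smul_eq_mul, mul_ite, mul_one, mul_zero]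
  simp only [← ite_and]
  rw [← Finset.sum_filter]
  refine Finset.sum_bij' (fun c _ => fun j i => c i j) (fun c _ => fun j i => c i j) ?_ ?_ ?_ ?_ ?_
  · intro c hc
    simp only [Finset.mem_filter, Fintype.mem_piFinset, Finset.mem_piAntidiag, matSet,
      Finset.Nat.mem_antidiagonalTuple, EmbeddingLike.apply_eq_iff_eq] at hc ⊢
    obtain ⟨h1, h2, h3⟩ := hc
    exact ⟨⟨fun j => congrFun h3 j, h2⟩, funext fun i => (h1 i).1⟩
  · intro c hc
    simp only [Finset.mem_filter, Fintype.mem_piFinset, Finset.mem_piAntidiag, matSet,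
      Finset.Nat.mem_antidiagonalTuple, EmbeddingLike.apply_eq_iff_eq] at hc ⊢
    obtain ⟨⟨h1, h2⟩, h3⟩ := hc
    exact ⟨fun i => ⟨congrFun h3 i, by simp⟩, h2, funext h1⟩
  · intros; rfl
  · intros; rfl
  · intros; rfl

lemma phiW_aux (w : List (ℕ × ℕ)) (d : ℕ) (h : w.length = d) (A B : Fin d → ℕ)
    (hf : ∀ i, w.get i = (A (Fin.cast h i), B (Fin.cast h i))) :
    phiW w = ∑ c ∈ matSet d B,
      ((∏ j, ((B j).factorial : ℚ)) *
        ∏ i, (Nat.multinomial Finset.univ (fun j => c j i) : ℚ)) •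
      wB (wordB A (fun i => ∑ j, c j i)) := by
  subst h
  unfold phiW wordB
  simp only [hf]
  rfl

lemma phiW_ofFn {d : ℕ} (A B : Fin d → ℕ) (S : Finset (Fin d → ℕ))
    (hS : ∀ a : Fin d → ℕ, ∑ i, a i = ∑ i, B i → a ∈ S) :
    phiW (List.ofFn fun i => (A i, B i)) = (∏ j, ((B j).factorial : ℚ)) •
      ∑ a ∈ S, MvPolynomial.coeff (Finsupp.equivFunOnFinite.symm B) (genP a) •
        wB (wordB A a) := by
  rw [phiW_aux _ d (by simp) A B (by intro i; simp; exact ⟨rfl, rfl⟩), Finset.smul_sum]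
  rw [← Finset.sum_fiberwise_of_maps_to (s := matSet d B) (t := S)
    (g := fun c => fun i => ∑ j, c j i)]
  · refine Finset.sum_congr rfl fun a _ => ?_
    rw [coeff_genP, Finset.sum_smul, Finset.smul_sum]
    refine Finset.sum_congr rfl fun c hc => ?_
    rw [(Finset.mem_filter.mp hc).2, smul_smul]
  · intro c hc
    apply hS
    simp only [Finset.mem_filter, Fintype.mem_piFinset, matSet,
      Finset.Nat.mem_antidiagonalTuple] at hc
    rw [Finset.sum_comm]
    exact Finset.sum_congr rfl fun j _ => hc.1 j


/-- the substituted variable for `Y_i` -/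
noncomputable def subZ (d : ℕ) (i : Fin d) : MvPolynomial (Fin d ⊕ Fin d) ℚ :=
  (∑ j : Fin d, if (j : ℕ) + (i : ℕ) = d - 1 then MvPolynomial.X (Sum.inl j) else 0) -
    (∑ j : Fin d, if (j : ℕ) + (i : ℕ) = d then MvPolynomial.X (Sum.inl j) else 0)

lemma sum_subZ {d : ℕ} (i : Fin d) :
    (∑ j : Fin d, if j ≤ i then subZ d j else 0) = MvPolynomial.X (Sum.inl i.rev) := by
  let U : ℕ → MvPolynomial (Fin d ⊕ Fin d) ℚ := fun n =>
    ∑ j : Fin d, if (j : ℕ) + n = d then MvPolynomial.X (Sum.inl j) else 0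
  have hU0 : U 0 = 0 := by
    apply Finset.sum_eq_zero
    intro j _
    rw [if_neg (by omega)]
  have hZ : ∀ j : Fin d, subZ d j = U (j + 1) - U j := by
    intro j
    unfold subZ
    congr 1
    refine Finset.sum_congr rfl fun l _ => ?_
    exact if_congr (by omega) rfl rfl
  have hUi : U (i + 1) = MvPolynomial.X (Sum.inl i.rev) := by
    show (∑ j : Fin d, _) = _
    rw [Finset.sum_eq_single i.rev]
    · rw [if_pos]
      simp only [Fin.val_rev]
      omega
    · intro j _ hj
      rw [if_neg]
      intro h
      apply hj
      ext
      simp only [Fin.val_rev]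
      omega
    · simp
  have h1 : (∑ j : Fin d, if j ≤ i then subZ d j else 0) =
      ∑ n ∈ Finset.range d, if n ≤ (i : ℕ) then U (n + 1) - U n else 0 := by
    rw [← Fin.sum_univ_eq_sum_range (fun n => if n ≤ (i : ℕ) then U (n + 1) - U n else 0)]
    refine Finset.sum_congr rfl fun j _ => ?_
    rw [hZ]
    rfl
  have h2 : (Finset.range d).filter (fun n => n ≤ (i : ℕ)) = Finset.range (i + 1) := by
    ext n
    simp only [Finset.mem_filter, Finset.mem_range]
    omega
  rw [h1, ← Finset.sum_filter, h2, Finset.sum_range_sub, hU0, hUi, sub_zero]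

lemma swapSub_eq {d : ℕ} (A B : Fin d → ℕ) :
    (∏ j, ((B j).factorial : ℚ)) • swapSubPoly d A B =
      MvPolynomial.rename Sum.inr (genP fun i => A i.rev) * ∏ i, subZ d i ^ B i := by
  have h1 : MvPolynomial.rename Sum.inr (genP fun i => A i.rev) =
      ∏ i : Fin d, (∑ j : Fin d, if (j : ℕ) + (i : ℕ) < d then
        (MvPolynomial.X (Sum.inr j) : MvPolynomial (Fin d ⊕ Fin d) ℚ) else 0) ^ A i := by
    unfold genP
    rw [map_prod, ← Equiv.prod_comp Fin.revPerm]
    refine Finset.prod_congr rfl fun i _ => ?_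
    simp only [Fin.revPerm_apply, Fin.rev_rev, map_pow, map_sum, apply_ite (MvPolynomial.rename _),
      MvPolynomial.rename_X, map_zero]
    congr 1
    refine Finset.sum_congr rfl fun j _ => ?_
    refine if_congr ?_ rfl rfl
    rw [Fin.le_def, Fin.val_rev]
    omega
  rw [h1, MvPolynomial.smul_eq_C_mul]
  unfold swapSubPoly subZ
  rw [map_prod, ← Finset.prod_mul_distrib, ← Finset.prod_mul_distrib]
  refine Finset.prod_congr rfl fun i _ => ?_
  rw [mul_comm, mul_assoc, ← MvPolynomial.C_mul, inv_mul_cancel₀, MvPolynomial.C_1, mul_one]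
  exact_mod_cast (B i).factorial_ne_zero

lemma key_coeff {d : ℕ} (x y A a : Fin d → ℕ) (S : Finset (Fin d → ℕ))
    (hS : ∀ B : Fin d → ℕ, ∑ i, B i ≤ ∑ i, (x i + y i) → B ∈ S) :
    ∑ B ∈ S, (MvPolynomial.coeff (Finsupp.equivFunOnFinite.symm (Sum.elim x y))
        (swapSubPoly d A B) * ((∏ j, ((B j).factorial : ℚ)) *
          MvPolynomial.coeff (Finsupp.equivFunOnFinite.symm B) (genP a))) =
      if a = (fun i => x i.rev) then
        MvPolynomial.coeff (Finsupp.equivFunOnFinite.symm y) (genP fun i => A i.rev) else 0 := by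
  classical
  set e := Finsupp.equivFunOnFinite.symm (Sum.elim x y) with he
  set Q := MvPolynomial.rename (Sum.inr : Fin d → Fin d ⊕ Fin d) (genP fun i => A i.rev) with hQ
  have hzero : ∀ B : Fin d → ℕ, B ∉ S → MvPolynomial.coeff e (swapSubPoly d A B) = 0 := by
    intro B hB
    apply (swapSub_homog d A B).coeff_eq_zero
    intro h
    apply hB
    apply hS
    rw [Finsupp.degree_eq_sum] at h
    simp only [he, Fintype.sum_sum_type, Finsupp.equivFunOnFinite_symm_apply_apply,
      Sum.elim_inl, Sum.elim_inr] at h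
    rw [Finset.sum_add_distrib, h, Finset.sum_add_distrib]
    omega
  have hterm : ∀ B : Fin d → ℕ, MvPolynomial.coeff e
        (swapSubPoly d A B) * ((∏ j, ((B j).factorial : ℚ)) *
          MvPolynomial.coeff (Finsupp.equivFunOnFinite.symm B) (genP a)) =
      MvPolynomial.coeff (Finsupp.equivFunOnFinite.symm B) (genP a) *
        MvPolynomial.coeff e (Q * ∏ i, subZ d i ^ B i) := by
    intro B
    rw [hQ, ← swapSub_eq, MvPolynomial.coeff_smul, smul_eq_mul]
    ring
  have hsub : MvPolynomial.aeval (subZ d) (genP a) =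
      MvPolynomial.rename Sum.inl (∏ i : Fin d, MvPolynomial.X i.rev ^ a i) := by
    unfold genP
    simp only [map_prod, map_pow, map_sum, apply_ite (MvPolynomial.aeval (subZ d)),
      MvPolynomial.aeval_X, map_zero, MvPolynomial.rename_X, sum_subZ]
  have hmon : (∏ i : Fin d, MvPolynomial.X i.rev ^ a i : MvPolynomial (Fin d) ℚ) =
      MvPolynomial.monomial (Finsupp.equivFunOnFinite.symm fun i => a i.rev) 1 := by
    rw [MvPolynomial.monomial_eq, Finsupp.prod_fintype _ _ (by simp),
      ← Equiv.prod_comp Fin.revPerm]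
    simp
  have hR : MvPolynomial.coeff e (Q * MvPolynomial.aeval (subZ d) (genP a)) =
      if a = (fun i => x i.rev) then
        MvPolynomial.coeff (Finsupp.equivFunOnFinite.symm y) (genP fun i => A i.rev) else 0 := by
    rw [hsub, hQ, he, coeff_rename_mul, hmon, MvPolynomial.coeff_monomial, ite_mul, one_mul,
      zero_mul]
    refine if_congr ?_ rfl rfl
    rw [EmbeddingLike.apply_eq_iff_eq]
    constructor
    · rintro rfl
      simp
    · rintro rfl
      simp
  rw [← hR, MvPolynomial.aeval_def, MvPolynomial.eval₂_eq', Finset.mul_sum,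
    MvPolynomial.coeff_sum]
  have hL : ∀ m : Fin d →₀ ℕ, MvPolynomial.coeff e (Q * ((algebraMap ℚ
        (MvPolynomial (Fin d ⊕ Fin d) ℚ)) (MvPolynomial.coeff m (genP a)) *
        ∏ i, subZ d i ^ m i)) =
      MvPolynomial.coeff m (genP a) * MvPolynomial.coeff e (Q * ∏ i, subZ d i ^ m i) := by
    intro m
    rw [mul_left_comm, MvPolynomial.algebraMap_eq, MvPolynomial.coeff_C_mul]
  simp only [hL]
  have hm : ∑ B ∈ S, MvPolynomial.coeff e
        (swapSubPoly d A B) * ((∏ j, ((B j).factorial : ℚ)) *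
          MvPolynomial.coeff (Finsupp.equivFunOnFinite.symm B) (genP a)) =
      ∑ m ∈ S.map Finsupp.equivFunOnFinite.symm.toEmbedding,
        MvPolynomial.coeff m (genP a) * MvPolynomial.coeff e (Q * ∏ i, subZ d i ^ m i) := by
    rw [Finset.sum_map]
    refine Finset.sum_congr rfl fun B _ => ?_
    rw [hterm]
    rfl
  rw [hm, Finset.sum_subset Finset.subset_union_left, Finset.sum_subset
    (Finset.subset_union_right (s₁ := S.map Finsupp.equivFunOnFinite.symm.toEmbedding)
      (s₂ := (genP a).support))]
  · intro m _ hm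
    rw [MvPolynomial.notMem_support_iff.mp hm, zero_mul]
  · intro m _ hm
    have hB : (m : Fin d → ℕ) ∉ S := by
      intro h
      apply hm
      rw [Finset.mem_map]
      exact ⟨m, h, by ext; simp⟩
    have := hterm m
    rw [hzero _ hB, zero_mul] at this
    rw [← Finsupp.equivFunOnFinite_symm_coe m] 
    exact this.symm

lemma phi_smul_wY (w : List (ℕ × ℕ)) : phi (wY w) = phiW w := by
  simp [phi, wY]

lemma phi_eq_lin (v : QY) : phi v = Finsupp.linearCombination ℚ phiW v := rfl

lemma main_word (swapF : QY →ₗ[ℚ] QY) (d : ℕ) (x y : Fin d → ℕ)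
    (hswap : swapF (wY (List.ofFn fun i => (x i, y i))) =
        (∏ i : Fin d, ((y i).factorial : ℚ)) •
          ∑ A ∈ Fintype.piFinset fun _ : Fin d =>
              Finset.range ((∑ i : Fin d, (x i + y i)) + 1),
            ∑ B ∈ Fintype.piFinset fun _ : Fin d =>
                Finset.range ((∑ i : Fin d, (x i + y i)) + 1),
              MvPolynomial.coeff (Finsupp.equivFunOnFinite.symm (Sum.elim x y))
                  (swapSubPoly d A B) •
                wY (List.ofFn fun i => (A i, B i))) :
    phi (swapF (wY (List.ofFn fun i => (x i, y i)))) =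
      tauQ (phi (wY (List.ofFn fun i => (x i, y i)))) := by
  classical
  set N := ∑ i : Fin d, (x i + y i) with hN
  set S := Fintype.piFinset fun _ : Fin d => Finset.range (N + 1) with hSdef
  have hS : ∀ B : Fin d → ℕ, ∑ i, B i ≤ N → B ∈ S := by
    intro B hB
    rw [hSdef, Fintype.mem_piFinset]
    intro i
    rw [Finset.mem_range]
    have := Finset.single_le_sum (f := B) (fun _ _ => Nat.zero_le _) (Finset.mem_univ i)
    omega
  have hyN : ∑ i, y i ≤ N := by
    rw [hN, Finset.sum_add_distrib]
    omega
  have hxN : ∑ i, x i ≤ N := by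
    rw [hN, Finset.sum_add_distrib]
    omega
  rw [hswap, phi_smul_wY, phiW_ofFn x y S (fun a ha => hS a (ha ▸ hyN)), phi_eq_lin, map_smul,
    map_sum]
  show _ = Finsupp.lmapDomain ℚ ℚ tauW _
  rw [map_smul, map_sum]
  congr 1
  have hterm : ∀ A B : Fin d → ℕ, MvPolynomial.coeff (Finsupp.equivFunOnFinite.symm (Sum.elim x y))
      (swapSubPoly d A B) • phiW (List.ofFn fun i => (A i, B i)) =
      ∑ a ∈ S, (MvPolynomial.coeff (Finsupp.equivFunOnFinite.symm (Sum.elim x y))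
        (swapSubPoly d A B) * ((∏ j, ((B j).factorial : ℚ)) *
          MvPolynomial.coeff (Finsupp.equivFunOnFinite.symm B) (genP a))) • wB (wordB A a) := by
    intro A B
    by_cases h : ∑ i, B i ≤ N
    · rw [phiW_ofFn A B S (fun a ha => hS a (ha ▸ h)), Finset.smul_sum, Finset.smul_sum]
      simp only [smul_smul]
    · have : MvPolynomial.coeff (Finsupp.equivFunOnFinite.symm (Sum.elim x y))
          (swapSubPoly d A B) = 0 := by
        apply (swapSub_homog d A B).coeff_eq_zero
        intro h'
        apply h
        rw [Finsupp.degree_eq_sum] at h'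
        simp only [Fintype.sum_sum_type, Finsupp.equivFunOnFinite_symm_apply_apply,
          Sum.elim_inl, Sum.elim_inr] at h'
        rw [hN, Finset.sum_add_distrib, h', Finset.sum_add_distrib]
        omega
      simp [this]
  have hA : ∀ A ∈ S, Finsupp.linearCombination ℚ phiW (∑ B ∈ S,
        MvPolynomial.coeff (Finsupp.equivFunOnFinite.symm (Sum.elim x y))
                  (swapSubPoly d A B) • wY (List.ofFn fun i => (A i, B i))) =
      MvPolynomial.coeff (Finsupp.equivFunOnFinite.symm y) (genP fun i => A i.rev) •
        wB (wordB A fun i => x i.rev) := by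
    intro A _
    rw [map_sum]
    simp only [map_smul, ← phi_eq_lin, phi_smul_wY, hterm]
    rw [Finset.sum_comm]
    simp only [← Finset.sum_smul, key_coeff x y A _ S hS]
    rw [Finset.sum_eq_single (fun i => x i.rev)]
    · simp
    · intro b _ hb
      simp [hb]
    · intro h
      exfalso
      apply h
      apply hS
      rw [← Equiv.sum_comp Fin.revPerm]
      simpa using hxN
  rw [Finset.sum_congr rfl hA]
  refine Finset.sum_bij' (fun A _ => fun i => A i.rev) (fun A _ => fun i => A i.rev) ?_ ?_ ?_ ?_ ?_
  · intro A hA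
    rw [hSdef, Fintype.mem_piFinset] at hA ⊢
    exact fun i => hA i.rev
  · intro A hA
    rw [hSdef, Fintype.mem_piFinset] at hA ⊢
    exact fun i => hA i.rev
  · intros; simp
  · intros; simp
  · intro A _
    rw [map_smul]
    congr 1
    simp only [wB, Finsupp.lmapDomain_apply, Finsupp.mapDomain_single, tauW_wordB, Fin.rev_rev]

/-- If `swap : ℚ⟨Y^bi⟩ → ℚ⟨Y^bi⟩` is the `ℚ`-linear map determined
by the defining generating-series property, then `φ_# ∘ swap = τ ∘ φ_#`. -/
theorem phi_sharp_intertwines_swap_tau (swapF : QY →ₗ[ℚ] QY)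
    (hswap : ∀ (d : ℕ) (x y : Fin d → ℕ),
      swapF (wY (List.ofFn fun i => (x i, y i))) =
        (∏ i : Fin d, ((y i).factorial : ℚ)) •
          ∑ A ∈ Fintype.piFinset fun _ : Fin d =>
              Finset.range ((∑ i : Fin d, (x i + y i)) + 1),
            ∑ B ∈ Fintype.piFinset fun _ : Fin d =>
                Finset.range ((∑ i : Fin d, (x i + y i)) + 1),
              MvPolynomial.coeff (Finsupp.equivFunOnFinite.symm (Sum.elim x y))
                  (swapSubPoly d A B) •
                wY (List.ofFn fun i => (A i, B i))) :
    ∀ v : QY, phi (swapF v) = tauQ (phi v) := by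
  intro v
  have h : (Finsupp.linearCombination ℚ phiW).comp swapF =
      (Finsupp.lmapDomain ℚ ℚ tauW).comp (Finsupp.linearCombination ℚ phiW) := by
    apply Finsupp.lhom_ext'
    intro w
    apply LinearMap.ext_ring
    have := main_word swapF w.length (fun i => (w.get i).1) (fun i => (w.get i).2) (hswap _ _ _)
    have hw : (List.ofFn fun i : Fin w.length => ((w.get i).1, (w.get i).2)) = w := by
      simp
    rw [hw] at this
    exact this
  exact LinearMap.congr_fun h v
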